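/- arXiv:1112.5129 — 2 statements merged into one kernel-verified Lean document; each statement's English description precedes it below -/
import Mathlib

section
/- Let T : ℝⁿ → ℝⁿ be an invertible linear map with |det T| = 1. For convex bodies K₁,…,K_n of class C²₊ and functions φ₁,…,φ_n ∈ Conc(0,∞), the general mixed L_φ-affine surface area satisfies as(φ₁, TK₁; …; φ_n, TK_n) = as(φ₁, K₁; …; φ_n, K_n). -/
open MeasureTheory Filter

/-- Membership in the class `Conc(0,∞)`: positive on `(0,∞)` and either a nonzero constant,
or concave with `φ(t) → 0` as `t → 0⁺` and `φ(t)/t → 0` as `t → ∞`. -/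
def MemConc (φ : ℝ → ℝ) : Prop :=
  (∀ t : ℝ, 0 < t → 0 < φ t) ∧
    ((∃ c : ℝ, 0 < c ∧ ∀ t : ℝ, 0 < t → φ t = c) ∨
      (ConcaveOn ℝ (Set.Ioi 0) φ ∧
        Tendsto φ (nhdsWithin 0 (Set.Ioi 0)) (nhds 0) ∧
        Tendsto (fun t => φ t / t) atTop (nhds 0)))


theorem aux_open_le {X : Type*} [MetricSpace X] [SecondCountableTopology X] [MeasurableSpace X]
    [BorelSpace X] (μ ν : Measure X) [IsFiniteMeasure μ] [IsFiniteMeasure ν]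
    (a : ℝ → ENNReal) (ha : ∀ r, 0 < r → a r ≠ 0)
    (hμ : ∀ x r, μ (Metric.ball x r) = a r) (hν : ∀ x r, ν (Metric.ball x r) = a r)
    (U : Set X) (hU : IsOpen U) : μ U ≤ ν U := by
  rcases U.eq_empty_or_nonempty with rfl | ⟨x0, -⟩
  · simp
  have hfin : ∀ r, a r ≠ ⊤ := fun r => by rw [← hμ x0 r]; exact measure_ne_top _ _
  let r : ℕ → ℝ := fun k => 1 / ((k : ℝ) + 1)
  have hr : ∀ k, 0 < r k := fun k => by positivity
  have hr0 : Tendsto r atTop (nhds 0) := tendsto_one_div_add_atTop_nhds_zero_nat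
  let s : ℕ → Set (X × X) := fun k => {p | dist p.1 p.2 < r k}
  have hs : ∀ k, MeasurableSet (s k) := fun k =>
    (isOpen_lt (continuous_fst.dist continuous_snd) continuous_const).measurableSet
  let f : ℕ → X → ENNReal := fun k x => (a (r k))⁻¹ * (ν.restrict U) (Prod.mk x ⁻¹' s k)
  have hf : ∀ k, Measurable (f k) := fun k =>
    (measurable_measure_prodMk_left (hs k)).const_mul _
  have h1 : ∀ x ∈ U, liminf (fun k => f k x) atTop = 1 := by
    intro x hx
    obtain ⟨ε, hε, hb⟩ := Metric.isOpen_iff.1 hU x hx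
    apply Tendsto.liminf_eq
    apply tendsto_const_nhds.congr'
    filter_upwards [hr0.eventually_lt_const hε] with k hk
    have : Prod.mk x ⁻¹' s k = Metric.ball x (r k) := by
      ext y; simp [s, Metric.mem_ball, dist_comm]
    simp only [f, this]
    rw [Measure.restrict_apply Metric.isOpen_ball.measurableSet,
      Set.inter_eq_left.2 ((Metric.ball_subset_ball hk.le).trans hb), hν,
      ENNReal.inv_mul_cancel (ha _ (hr k)) (hfin _)]
  have h2 : ∀ k, ∫⁻ x in U, f k x ∂μ ≤ ν U := by
    intro k
    simp only [f]
    rw [lintegral_const_mul _ (measurable_measure_prodMk_left (hs k)),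
      ← Measure.prod_apply (hs k), Measure.prod_apply_symm (hs k)]
    calc _ ≤ (a (r k))⁻¹ * ∫⁻ y in U, a (r k) ∂ν := by
          gcongr with y
          rw [← hμ y (r k)]
          refine (Measure.restrict_apply_le _ _).trans (measure_mono ?_)
          intro x hx; simpa [s] using hx
      _ = ν U := by
          rw [lintegral_const, Measure.restrict_apply_univ, ← mul_assoc,
            ENNReal.inv_mul_cancel (ha _ (hr k)) (hfin _), one_mul]
  calc μ U = ∫⁻ x in U, 1 ∂μ := by simp
    _ = ∫⁻ x in U, liminf (fun k => f k x) atTop ∂μ :=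
        (setLIntegral_congr_fun hU.measurableSet h1).symm
    _ ≤ liminf (fun k => ∫⁻ x in U, f k x ∂μ) atTop := lintegral_liminf_le hf
    _ ≤ liminf (fun _ : ℕ => ν U) atTop := liminf_le_liminf (.of_forall h2)
    _ = ν U := by simp

theorem aux_unique {X : Type*} [MetricSpace X] [SecondCountableTopology X] [MeasurableSpace X]
    [BorelSpace X] (μ ν : Measure X) [IsFiniteMeasure μ] [IsFiniteMeasure ν]
    (a b : ℝ → ENNReal) (hb : ∀ r, 0 < r → b r ≠ 0)
    (hμ : ∀ x r, μ (Metric.ball x r) = a r) (hν : ∀ x r, ν (Metric.ball x r) = b r) :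
    ∃ c : ENNReal, μ = c • ν := by
  by_cases hμ0 : μ Set.univ = 0
  · exact ⟨0, by simpa using hμ0⟩
  by_cases hν0 : ν Set.univ = 0
  · exfalso
    rcases isEmpty_or_nonempty X with h | ⟨⟨x⟩⟩
    · exact hμ0 (by simp [Set.univ_eq_empty_iff.2 h])
    · exact hb 1 one_pos (by rw [← hν x 1]; exact measure_mono_null (Set.subset_univ _) hν0)
  have key : ∀ r, ν Set.univ * a r = μ Set.univ * b r := by
    intro r
    have hs : MeasurableSet {p : X × X | dist p.1 p.2 < r} :=
      (isOpen_lt (continuous_fst.dist continuous_snd) continuous_const).measurableSet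
    have e1 := Measure.prod_apply (μ := μ) (ν := ν) hs
    have e2 := Measure.prod_apply_symm (μ := μ) (ν := ν) hs
    have i1 : ∀ x, ν (Prod.mk x ⁻¹' {p : X × X | dist p.1 p.2 < r}) = b r := fun x => by
      rw [← hν x r]; congr 1; ext y; simp [Metric.mem_ball, dist_comm]
    have i2 : ∀ y, μ ((fun x => (x, y)) ⁻¹' {p : X × X | dist p.1 p.2 < r}) = a r := fun y => by
      rw [← hμ y r]; congr 1
    simp only [i1, i2, lintegral_const] at e1 e2
    rw [mul_comm, ← e2, e1, mul_comm]
  have : IsFiniteMeasure (ν Set.univ • μ) := Measure.smul_finite _ (measure_ne_top _ _)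
  have : IsFiniteMeasure (μ Set.univ • ν) := Measure.smul_finite _ (measure_ne_top _ _)
  have h0 : ∀ r, 0 < r → μ Set.univ * b r ≠ 0 := fun r hr => mul_ne_zero hμ0 (hb r hr)
  have p1 : ∀ x r, (ν Set.univ • μ) (Metric.ball x r) = μ Set.univ * b r := fun x r => by
    simp [hμ, key]
  have p2 : ∀ x r, (μ Set.univ • ν) (Metric.ball x r) = μ Set.univ * b r := fun x r => by
    simp [hν]
  have heq : ν Set.univ • μ = μ Set.univ • ν := by
    apply Measure.OuterRegular.ext_isOpen
    intro U hU
    exact le_antisymm (aux_open_le _ _ _ h0 p1 p2 U hU) (aux_open_le _ _ _ h0 p2 p1 U hU)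
  refine ⟨(ν Set.univ)⁻¹ * μ Set.univ, ?_⟩
  rw [← smul_smul, ← heq, smul_smul, ENNReal.inv_mul_cancel hν0 (measure_ne_top _ _), one_smul]


section
variable {E : Type*} [NormedAddCommGroup E] [NormedSpace ℝ E]

noncomputable def sphMap (A : E →ₗ[ℝ] E) (hA : Function.Injective A)
    (u : Metric.sphere (0 : E) 1) : Metric.sphere (0 : E) 1 :=
  ⟨‖A u‖⁻¹ • A u, by
    have : A u ≠ 0 := by
      rw [Ne, map_eq_zero_iff A hA]; exact ne_zero_of_mem_unit_sphere u
    simp [norm_smul, this]⟩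

theorem sphMap_norm_pos (A : E →ₗ[ℝ] E) (hA : Function.Injective A)
    (u : Metric.sphere (0 : E) 1) : 0 < ‖A u‖ := by
  rw [norm_pos_iff, Ne, map_eq_zero_iff A hA]; exact ne_zero_of_mem_unit_sphere u

theorem sphMap_injective (A : E →ₗ[ℝ] E) (hA : Function.Injective A) :
    Function.Injective (sphMap A hA) := by
  intro u v h
  have h1 := congrArg Subtype.val h
  simp only [sphMap, ← map_smul] at h1
  have h2 := hA h1
  have hu := sphMap_norm_pos A hA u
  have hv := sphMap_norm_pos A hA v
  have nu : ‖(u : E)‖ = 1 := by simp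
  have nv : ‖(v : E)‖ = 1 := by simp
  have h3 := congrArg norm h2
  simp only [norm_smul, nu, nv, norm_inv, norm_norm, mul_one] at h3
  rw [h3] at h2
  exact Subtype.ext (smul_right_injective E (inv_ne_zero hv.ne') h2)

theorem sphMap_continuous [FiniteDimensional ℝ E] (A : E →ₗ[ℝ] E) (hA : Function.Injective A) :
    Continuous (sphMap A hA) := by
  have hc : Continuous fun u : Metric.sphere (0 : E) 1 => A u :=
    A.continuous_of_finiteDimensional.comp continuous_subtype_val
  exact Continuous.subtype_mk ((hc.norm.inv₀ fun u => (sphMap_norm_pos A hA u).ne').smul hc) _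

open Pointwise in
theorem toSphere_transform [FiniteDimensional ℝ E] [MeasurableSpace E] [BorelSpace E]
    [Nontrivial E] (μ : Measure E) [μ.IsAddHaarMeasure]
    (A : E →ₗ[ℝ] E) (hA : Function.Injective A) (hdet : |LinearMap.det A| = 1) :
    μ.toSphere = (μ.toSphere.withDensity
      (fun u => ((‖A u‖₊⁻¹ ^ (Module.finrank ℝ E) : NNReal) : ENNReal))).map (sphMap A hA) := by
  have hd0 : LinearMap.det A ≠ 0 := fun h => by simp [h] at hdet
  have hcont := sphMap_continuous A hA
  have hc : Continuous fun u : Metric.sphere (0 : E) 1 => A u :=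
    A.continuous_of_finiteDimensional.comp continuous_subtype_val
  ext s hs
  rw [Measure.map_apply hcont.measurable hs, withDensity_apply _ (hcont.measurable hs),
    Measure.toSphere_apply' _ hs]
  set n := Module.finrank ℝ E with hn
  have hnpos : 0 < n := Module.finrank_pos
  let W : Set (Metric.sphere (0 : E) 1 × Set.Ioi (0 : ℝ)) :=
    {p | p.1 ∈ sphMap A hA ⁻¹' s ∧ (p.2 : ℝ) * ‖A p.1‖ < 1}
  have hW : MeasurableSet W := by
    refine (measurable_fst (hcont.measurable hs)).inter (IsOpen.measurableSet ?_)
    exact isOpen_lt ((continuous_subtype_val.comp continuous_snd).mul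
      (hc.comp continuous_fst).norm) continuous_const
  have hset : A ⁻¹' (Set.Ioo (0 : ℝ) 1 • (Subtype.val '' s))
      = Subtype.val '' (homeomorphUnitSphereProd E ⁻¹' W) := by
    ext x
    simp only [Set.mem_preimage, Set.mem_smul, Set.mem_image, Set.mem_Ioo]
    constructor
    · rintro ⟨t, ⟨ht0, ht1⟩, _, ⟨v, hv, rfl⟩, hx⟩
      have hx0 : x ≠ 0 := by
        rintro rfl
        simp [ht0.ne', ne_zero_of_mem_unit_sphere v] at hx
      have hxn : 0 < ‖x‖ := norm_pos_iff.2 hx0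
      have hAx : ‖A x‖ = t := by rw [← hx]; simp [norm_smul, abs_of_pos ht0]
      refine ⟨⟨x, hx0⟩, ⟨?_, ?_⟩, rfl⟩
      · have : sphMap A hA (homeomorphUnitSphereProd E ⟨x, hx0⟩).1 = v := by
          ext1
          simp only [sphMap, homeomorphUnitSphereProd_apply_fst_coe, map_smul, norm_smul, norm_inv,
            norm_norm, hAx, smul_smul]
          rw [← hx, smul_smul]
          have : (‖x‖⁻¹ * t)⁻¹ * ‖x‖⁻¹ * t = 1 := by field_simp
          rw [this, one_smul]
        rw [Set.mem_preimage, this]; exact hv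
      · simp only [homeomorphUnitSphereProd_apply_fst_coe, homeomorphUnitSphereProd_apply_snd_coe,
          map_smul, norm_smul, norm_inv, norm_norm, hAx]
        rw [← mul_assoc, mul_inv_cancel₀ hxn.ne', one_mul]; exact ht1
    · rintro ⟨⟨x, hx0⟩, ⟨h1, h2⟩, rfl⟩
      have hx0 : x ≠ 0 := hx0
      have hxn : 0 < ‖x‖ := norm_pos_iff.2 hx0
      have hAx : 0 < ‖A x‖ := by
        rw [norm_pos_iff, Ne, map_eq_zero_iff A hA]; exact hx0
      refine ⟨‖A x‖, ⟨hAx, ?_⟩, _, ⟨_, h1, rfl⟩, ?_⟩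
      · simp only [homeomorphUnitSphereProd_apply_fst_coe, homeomorphUnitSphereProd_apply_snd_coe,
          map_smul, norm_smul, norm_inv, norm_norm] at h2
        rwa [← mul_assoc, mul_inv_cancel₀ hxn.ne', one_mul] at h2
      · simp only [sphMap, homeomorphUnitSphereProd_apply_fst_coe, map_smul, norm_smul, norm_inv,
            norm_norm, smul_smul]
        have : ‖A x‖ * ((‖x‖⁻¹ * ‖A x‖)⁻¹ * ‖x‖⁻¹) = 1 := by field_simp
        rw [this, one_smul]
  have hvol : μ (Set.Ioo (0 : ℝ) 1 • (Subtype.val '' s))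
      = (μ.toSphere.prod (Measure.volumeIoiPow (n - 1))) W := by
    rw [← (μ.measurePreserving_homeomorphUnitSphereProd).measure_preimage hW.nullMeasurableSet,
      comap_subtype_coe_apply (measurableSet_singleton _).compl, ← hset,
      Measure.addHaar_preimage_linearMap μ hd0, abs_inv, hdet]
    simp
  rw [hvol, Measure.prod_apply hW, ← lintegral_const_mul _ (measurable_measure_prodMk_left hW),
    ← lintegral_indicator (hcont.measurable hs)]
  refine lintegral_congr fun u => ?_
  have hu := sphMap_norm_pos A hA u
  by_cases hus : u ∈ sphMap A hA ⁻¹' s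
  · rw [Set.indicator_of_mem hus]
    have : Prod.mk u ⁻¹' W = Set.Iio (⟨‖A u‖⁻¹, inv_pos.2 hu⟩ : Set.Ioi (0 : ℝ)) := by
      ext r
      simp only [W, Set.mem_preimage, Set.mem_ofPred_eq, Set.mem_Iio, ← Subtype.coe_lt_coe]
      rw [← one_div, lt_div_iff₀ hu]
      exact ⟨fun h => h.2, fun h => ⟨hus, h⟩⟩
    rw [this, Measure.volumeIoiPow_apply_Iio, Nat.sub_add_cancel hnpos, Nat.cast_pred hnpos,
      sub_add_cancel, ← ENNReal.ofReal_natCast, ← ENNReal.ofReal_mul (by positivity),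
      mul_div_cancel₀ _ (by positivity), ENNReal.ofReal]
    congr 1
    ext
    simp
  · rw [Set.indicator_of_notMem hus]
    have : Prod.mk u ⁻¹' W = ∅ := by
      ext r
      simp only [W, Set.mem_preimage, Set.mem_ofPred_eq, Set.mem_empty_iff_false, iff_false]
      exact fun h => hus h.1
    simp [this]

end

theorem det_adj {n : ℕ} (B : EuclideanSpace ℝ (Fin n) →ₗ[ℝ] EuclideanSpace ℝ (Fin n)) :
    LinearMap.det (LinearMap.adjoint B) = LinearMap.det B := by
  let v := EuclideanSpace.basisFun (Fin n) ℝ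
  rw [← LinearMap.det_toMatrix v.toBasis, LinearMap.toMatrix_adjoint v v, Matrix.det_conjTranspose,
    LinearMap.det_toMatrix]
  simp

theorem hausdorff_finite (m : ℕ) :
    (μH[(m : ℝ)] : Measure (Metric.sphere (0 : EuclideanSpace ℝ (Fin (m + 1))) 1)) Set.univ < ⊤ := by
  let Q : Set (Fin m → ℝ) := Metric.closedBall 0 1
  let F : Fin (m + 1) → ℝ → (Fin m → ℝ) → EuclideanSpace ℝ (Fin (m + 1)) :=
    fun i t y => WithLp.toLp 2 (i.insertNth (α := fun _ => ℝ) t y)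
  have hF1 : ∀ i t y, |t| ≤ ‖F i t y‖ := fun i t y => by
    simpa [F] using PiLp.norm_apply_le (F i t y) i
  have hF0 : ∀ i t y, t ≠ 0 → ‖F i t y‖ ≠ 0 := fun i t y ht =>
    ((abs_pos.2 ht).trans_le (hF1 i t y)).ne'
  obtain ⟨C, hC⟩ : ∃ C : NNReal, ∀ i t, LipschitzWith C (F i t) := by
    refine ⟨_, fun i t => (PiLp.lipschitzWith_toLp 2 (fun _ : Fin (m + 1) => ℝ)).comp
      (g := fun y : Fin m → ℝ => (i.insertNth (α := fun _ => ℝ) t y)) (Kg := 1) ?_⟩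
    refine LipschitzWith.of_dist_le_mul fun y z => ?_
    rw [Fin.dist_insertNth_insertNth]
    simp
  let S := Metric.sphere (0 : EuclideanSpace ℝ (Fin (m + 1))) 1
  let G : Fin (m + 1) → ({t : ℝ // t = 1 ∨ t = -1}) → (Fin m → ℝ) → S :=
    fun i t y => ⟨‖F i t y‖⁻¹ • F i t y, by
      have : ‖F i t y‖ ≠ 0 := hF0 i t y (by rcases t with ⟨t, rfl | rfl⟩ <;> simp)
      rw [mem_sphere_zero_iff_norm, norm_smul, norm_inv, norm_norm]
      exact inv_mul_cancel₀ this⟩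
  have hG : ∀ i t, LipschitzWith (2 * C) (G i t) := by
    intro i t
    refine LipschitzWith.of_dist_le_mul fun y z => ?_
    have ht : |(t : ℝ)| = 1 := by rcases t with ⟨t, rfl | rfl⟩ <;> simp
    have h1 := hF1 i t y
    have h2 := hF1 i t z
    rw [ht] at h1 h2
    have h3 := (hC i t).dist_le_mul y z
    rw [dist_eq_norm] at h3
    rw [Subtype.dist_eq, dist_eq_norm]
    simp only [G]
    set a := F i t y
    set b := F i t z
    have ha : 0 < ‖a‖ := by linarith
    have hb : 0 < ‖b‖ := by linarith
    have e : ‖a‖⁻¹ • a - ‖b‖⁻¹ • b = ‖a‖⁻¹ • (a - b) + (‖a‖⁻¹ - ‖b‖⁻¹) • b := by module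
    have h4 : |‖a‖⁻¹ - ‖b‖⁻¹| * ‖b‖ = ‖a‖⁻¹ * |‖b‖ - ‖a‖| := by
      have : ‖a‖⁻¹ - ‖b‖⁻¹ = ‖a‖⁻¹ * (‖b‖ - ‖a‖) * ‖b‖⁻¹ := by field_simp
      rw [this, abs_mul, abs_mul, abs_of_pos (inv_pos.2 ha), abs_of_pos (inv_pos.2 hb)]
      field_simp
    have h5 : |‖b‖ - ‖a‖| ≤ ‖a - b‖ := by
      rw [norm_sub_rev]; exact abs_norm_sub_norm_le b a
    have h6 : ‖a‖⁻¹ ≤ 1 := inv_le_one_of_one_le₀ h1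
    calc _ ≤ ‖‖a‖⁻¹ • (a - b)‖ + ‖(‖a‖⁻¹ - ‖b‖⁻¹) • b‖ := by rw [e]; exact norm_add_le _ _
      _ = ‖a‖⁻¹ * ‖a - b‖ + ‖a‖⁻¹ * |‖b‖ - ‖a‖| := by
        rw [norm_smul, norm_smul, Real.norm_eq_abs, Real.norm_eq_abs, h4,
          abs_of_pos (inv_pos.2 ha)]
      _ ≤ 1 * ‖a - b‖ + 1 * ‖a - b‖ := by gcongr
      _ ≤ _ := by push_cast; linarith
  have hQ : (μH[(m : ℝ)] : Measure (Fin m → ℝ)) Q < ⊤ := by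
    have h := hausdorffMeasure_pi_real (ι := Fin m)
    rw [Fintype.card_fin] at h
    rw [h]
    exact measure_closedBall_lt_top
  have hcov : (Set.univ : Set S) ⊆ ⋃ i, ⋃ t ∈ ({⟨1, .inl rfl⟩, ⟨-1, .inr rfl⟩} :
      Set {t : ℝ // t = 1 ∨ t = -1}), G i t '' Q := by
    intro u _
    obtain ⟨i, -, hi⟩ := Finset.exists_max_image Finset.univ (fun i => |(u : EuclideanSpace ℝ (Fin (m + 1))) i|)
      ⟨0, Finset.mem_univ _⟩
    have hu : ‖(u : EuclideanSpace ℝ (Fin (m + 1)))‖ = 1 := by simp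
    set x := (u : EuclideanSpace ℝ (Fin (m + 1))) with hx
    have hxi : 0 < |x i| := by
      by_contra h
      have : x = 0 := by
        ext j
        have := hi j (Finset.mem_univ _)
        exact abs_nonpos_iff.1 (this.trans (not_lt.1 h))
      simp [this] at hu
    simp only [Set.mem_iUnion]
    have hsg : x i / |x i| = 1 ∨ x i / |x i| = -1 := by
      rcases lt_or_gt_of_ne (abs_pos.1 hxi) with h | h
      · right; rw [abs_of_neg h, div_neg, div_self h.ne]
      · left; rw [abs_of_pos h]; field_simp
    refine ⟨i, ⟨x i / |x i|, hsg⟩, ?_, fun j => x (i.succAbove j) / |x i|, ?_, ?_⟩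
    · rcases hsg with h | h <;> simp [h]
    · simp only [Q, mem_closedBall_zero_iff]
      rw [pi_norm_le_iff_of_nonneg zero_le_one]
      intro j
      rw [Real.norm_eq_abs, abs_div, abs_abs, div_le_one hxi]
      exact hi _ (Finset.mem_univ _)
    · have hFx : F i (x i / |x i|) (fun j => x (i.succAbove j) / |x i|) = |x i|⁻¹ • x := by
        ext j
        refine Fin.succAboveCases i ?_ (fun j => ?_) j
        · simp [F, div_eq_inv_mul]
        · simp [F, div_eq_inv_mul]
      ext1
      simp only [G, hFx, norm_smul, hu, smul_smul, norm_inv, Real.norm_eq_abs, abs_abs, mul_one,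
        inv_inv]
      rw [mul_inv_cancel₀ hxi.ne', one_smul]
  have him : ∀ i t, μH[(m : ℝ)] (G i t '' Q) < ⊤ := fun i t => by
    refine (((hG i t).lipschitzOnWith (s := Q)).hausdorffMeasure_image_le
      (Nat.cast_nonneg m)).trans_lt (ENNReal.mul_lt_top ?_ hQ)
    exact ENNReal.rpow_lt_top_of_nonneg (Nat.cast_nonneg m) ENNReal.coe_ne_top
  refine (measure_mono hcov).trans_lt ?_
  refine (measure_iUnion_le _).trans_lt ?_
  rw [tsum_fintype]
  refine ENNReal.sum_lt_top.2 fun i _ => ?_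
  rw [Set.biUnion_insert, Set.biUnion_singleton]
  exact (measure_union_le _ _).trans_lt (ENNReal.add_lt_top.2 ⟨him _ _, him _ _⟩)


theorem hausdorff_eq_smul {n : ℕ} (hn : 0 < n) :
    ∃ c : ENNReal, (μH[(n - 1 : ℝ)] : Measure (Metric.sphere (0 : EuclideanSpace ℝ (Fin n)) 1))
      = c • (volume : Measure (EuclideanSpace ℝ (Fin n))).toSphere := by
  obtain ⟨m, rfl⟩ : ∃ m, n = m + 1 := ⟨n - 1, by omega⟩
  have hm : (((m + 1 : ℕ) : ℝ) - 1) = (m : ℝ) := by push_cast; ring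
  rw [hm]
  have : IsFiniteMeasure
      (μH[(m : ℝ)] : Measure (Metric.sphere (0 : EuclideanSpace ℝ (Fin (m + 1))) 1)) :=
    ⟨hausdorff_finite m⟩
  let p : Metric.sphere (0 : EuclideanSpace ℝ (Fin (m + 1))) 1 := ⟨EuclideanSpace.single 0 1, by simp⟩
  have hrot : ∀ x : Metric.sphere (0 : EuclideanSpace ℝ (Fin (m + 1))) 1, ∀ r : ℝ,
      μH[(m : ℝ)] (Metric.ball x r) = μH[(m : ℝ)] (Metric.ball p r) ∧
      (volume : Measure (EuclideanSpace ℝ (Fin (m + 1)))).toSphere (Metric.ball x r)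
        = (volume : Measure (EuclideanSpace ℝ (Fin (m + 1)))).toSphere (Metric.ball p r) := by
    intro x r
    let R : EuclideanSpace ℝ (Fin (m + 1)) ≃ₗᵢ[ℝ] EuclideanSpace ℝ (Fin (m + 1)) := (Submodule.span ℝ {(p : EuclideanSpace ℝ (Fin (m + 1))) - x})ᗮ.reflection
    have hR : R p = x := Submodule.reflection_sub (by simp)
    let A : EuclideanSpace ℝ (Fin (m + 1)) →ₗ[ℝ] EuclideanSpace ℝ (Fin (m + 1)) := R.toLinearEquiv.toLinearMap
    have hA : Function.Injective A := R.injective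
    have hnorm : ∀ u : EuclideanSpace ℝ (Fin (m + 1)), ‖A u‖ = ‖u‖ := fun u => R.norm_map u
    have hdet : |LinearMap.det A| = 1 := by
      rw [← Real.norm_eq_abs, ← LinearMap.normDet_eq_norm_det]
      exact R.toLinearIsometry.normDet_eq_one
    have hval : ∀ u, (sphMap A hA u : EuclideanSpace ℝ (Fin (m + 1))) = R u := fun u => by
      have : ‖A u‖ = 1 := by rw [hnorm]; simp
      simp only [sphMap, this, inv_one, one_smul]
      rfl
    have hiso : Isometry (sphMap A hA) := by
      refine Isometry.of_dist_eq fun u v => ?_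
      rw [Subtype.dist_eq, hval, hval, R.dist_map, Subtype.dist_eq]
    have hsurj : Function.Surjective (sphMap A hA) := by
      intro v
      refine ⟨⟨R.symm v, by simp⟩, ?_⟩
      ext1
      rw [hval]
      simp
    have hp : sphMap A hA p = x := by
      ext1
      rw [hval, hR]
    have hpre : sphMap A hA ⁻¹' Metric.ball x r = Metric.ball p r := by
      rw [← hp, hiso.preimage_ball]
    constructor
    · rw [← hpre, hiso.hausdorffMeasure_preimage (.inr hsurj), hsurj.range_eq, Set.inter_univ]
    · have h := toSphere_transform (volume : Measure (EuclideanSpace ℝ (Fin (m + 1)))) A hA hdet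
      have h1 : (fun u : Metric.sphere (0 : EuclideanSpace ℝ (Fin (m + 1))) 1 =>
          ((‖A u‖₊⁻¹ ^ (Module.finrank ℝ (EuclideanSpace ℝ (Fin (m + 1)))) : NNReal) : ENNReal)) = 1 := by
        funext u
        have : ‖A u‖₊ = 1 := by
          ext
          rw [coe_nnnorm, hnorm]; simp
        simp [this]
      rw [h1, withDensity_one] at h
      nth_rewrite 1 [h]
      rw [Measure.map_apply hiso.continuous.measurable Metric.isOpen_ball.measurableSet, hpre]
  refine aux_unique _ _ (fun r => μH[(m : ℝ)] (Metric.ball p r))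
    (fun r => (volume : Measure (EuclideanSpace ℝ (Fin (m + 1)))).toSphere (Metric.ball p r)) (fun r hr => ?_)
    (fun x r => (hrot x r).1) (fun x r => (hrot x r).2)
  exact (Metric.isOpen_ball.measure_pos _ ⟨p, Metric.mem_ball_self hr⟩).ne'

/-- affine invariance of the general mixed `L_φ`-affine surface area under
volume-preserving linear maps.  The bodies `K_i` and `TK_i` of class `C²₊` are encoded by
their support functions `hK i`, `hTK i` and curvature functions `fK i`, `fTK i`, related by
the standard transformation rules at `v = T^{-t}u/‖T^{-t}u‖`. -/
theorem stmt9 {n : ℕ} (hn : 0 < n)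
    (T : EuclideanSpace ℝ (Fin n) ≃ₗ[ℝ] EuclideanSpace ℝ (Fin n))
    (hdet : |LinearMap.det T.toLinearMap| = 1)
    (hK fK hTK fTK : Fin n → EuclideanSpace ℝ (Fin n) → ℝ)
    (hKpos : ∀ i x, ‖x‖ = 1 → 0 < hK i x) (fKpos : ∀ i x, ‖x‖ = 1 → 0 < fK i x)
    (hTKpos : ∀ i x, ‖x‖ = 1 → 0 < hTK i x) (fTKpos : ∀ i x, ‖x‖ = 1 → 0 < fTK i x)
    (hKcont : ∀ i, Continuous (hK i)) (fKcont : ∀ i, Continuous (fK i))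
    (hTKcont : ∀ i, Continuous (hTK i)) (fTKcont : ∀ i, Continuous (fTK i))
    (htrans1 : ∀ i, ∀ u : EuclideanSpace ℝ (Fin n), ‖u‖ = 1 →
      fTK i (‖(LinearMap.adjoint T.symm.toLinearMap) u‖⁻¹ • (LinearMap.adjoint T.symm.toLinearMap) u)
          * hTK i (‖(LinearMap.adjoint T.symm.toLinearMap) u‖⁻¹ • (LinearMap.adjoint T.symm.toLinearMap) u) ^ (n + 1)
        = (LinearMap.det T.toLinearMap) ^ 2 * fK i u * hK i u ^ (n + 1))
    (htrans2 : ∀ i, ∀ u : EuclideanSpace ℝ (Fin n), ‖u‖ = 1 →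
      fTK i (‖(LinearMap.adjoint T.symm.toLinearMap) u‖⁻¹ • (LinearMap.adjoint T.symm.toLinearMap) u)
          * hTK i (‖(LinearMap.adjoint T.symm.toLinearMap) u‖⁻¹ • (LinearMap.adjoint T.symm.toLinearMap) u)
        = (LinearMap.det T.toLinearMap) ^ 2 * ‖(LinearMap.adjoint T.symm.toLinearMap) u‖ ^ (n : ℕ)
            * fK i u * hK i u)
    (φ : Fin n → ℝ → ℝ) (hφ : ∀ i, MemConc (φ i)) :
    (∫ u : Metric.sphere (0 : EuclideanSpace ℝ (Fin n)) 1,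
        ∏ i, (φ i (1 / (fTK i u * hTK i (u : EuclideanSpace ℝ (Fin n)) ^ (n + 1)))
          * hTK i u * fTK i u) ^ ((n : ℝ)⁻¹) ∂(μH[(n - 1 : ℝ)]))
      = ∫ u : Metric.sphere (0 : EuclideanSpace ℝ (Fin n)) 1,
          ∏ i, (φ i (1 / (fK i u * hK i (u : EuclideanSpace ℝ (Fin n)) ^ (n + 1)))
            * hK i u * fK i u) ^ ((n : ℝ)⁻¹) ∂(μH[(n - 1 : ℝ)]) := by
  have hd2 : (LinearMap.det T.toLinearMap) ^ 2 = 1 := by rw [← sq_abs, hdet, one_pow]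
  set A := LinearMap.adjoint T.symm.toLinearMap with hAdef
  have hdA : |LinearMap.det A| = 1 := by
    rw [hAdef, det_adj]
    have h : LinearMap.det T.symm.toLinearMap * LinearMap.det T.toLinearMap = 1 :=
      LinearEquiv.det_symm_mul_det T
    have := congrArg abs h
    rwa [abs_mul, hdet, mul_one, abs_one] at this
  have hA : Function.Injective A := by
    have h0 : LinearMap.det A ≠ 0 := fun h => by simp [h] at hdA
    exact (LinearMap.equivOfDetNeZero A h0).injective
  have : Nonempty (Fin n) := ⟨⟨0, hn⟩⟩
  obtain ⟨c, hc⟩ := hausdorff_eq_smul hn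
  rw [hc, integral_smul_measure, integral_smul_measure]
  congr 1
  have hemb : MeasurableEmbedding (sphMap A hA) :=
    (sphMap_continuous A hA).measurableEmbedding (sphMap_injective A hA)
  have hmeas : Measurable fun u : Metric.sphere (0 : EuclideanSpace ℝ (Fin n)) 1 =>
      ‖A u‖₊⁻¹ ^ (Module.finrank ℝ (EuclideanSpace ℝ (Fin n))) := by
    have : Continuous fun u : Metric.sphere (0 : EuclideanSpace ℝ (Fin n)) 1 => A u :=
      A.continuous_of_finiteDimensional.comp continuous_subtype_val
    exact (this.measurable.nnnorm.inv).pow_const _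
  conv_lhs => rw [toSphere_transform volume A hA hdA]
  rw [hemb.integral_map, integral_withDensity_eq_integral_smul hmeas]
  congr 1
  funext u
  have hu1 : ‖(u : EuclideanSpace ℝ (Fin n))‖ = 1 := by simp
  have hu := sphMap_norm_pos A hA u
  have hterm : ∀ i, (φ i (1 / (fTK i (sphMap A hA u) * hTK i (sphMap A hA u) ^ (n + 1)))
          * hTK i (sphMap A hA u) * fTK i (sphMap A hA u)) ^ ((n : ℝ)⁻¹)
      = (φ i (1 / (fK i u * hK i u ^ (n + 1))) * hK i u * fK i u) ^ ((n : ℝ)⁻¹) * ‖A u‖ := by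
    intro i
    have t1 := htrans1 i u hu1
    have t2 := htrans2 i u hu1
    rw [hd2, one_mul] at t1 t2
    simp only [sphMap]
    have hpos : 0 < φ i (1 / (fK i u * hK i u ^ (n + 1))) := by
      apply (hφ i).1
      have := hKpos i u hu1
      have := fKpos i u hu1
      positivity
    have h1 := hKpos i u hu1
    have h2 := fKpos i u hu1
    rw [t1, mul_assoc, mul_comm (hTK i _), t2]
    have e : φ i (1 / (fK i u * hK i u ^ (n + 1))) * (‖A u‖ ^ n * fK i u * hK i u)
        = (φ i (1 / (fK i u * hK i u ^ (n + 1))) * hK i u * fK i u) * ‖A u‖ ^ n := by ring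
    rw [e, Real.mul_rpow (by positivity) (by positivity), Real.pow_rpow_inv_natCast hu.le hn.ne']
  rw [Finset.prod_congr rfl fun i _ => hterm i, Finset.prod_mul_distrib, Finset.prod_const,
    Finset.card_univ, Fintype.card_fin, NNReal.smul_def, smul_eq_mul, finrank_euclideanSpace_fin]
  push_cast
  rw [mul_comm, mul_assoc, ← mul_pow, mul_inv_cancel₀ hu.ne', one_pow, mul_one]
end

section
/- Let T : ℝⁿ → ℝⁿ be an invertible linear map, K₁,…,K_n convex bodies of class C²₊, and φ₁,…,φ_n ∈ Conc(0,∞) homogeneous of degrees r₁,…,r_n ∈ [0,1). Then as(φ₁, TK₁; …; φ_n, TK_n) = |det T|^{1 - 2(r₁+⋯+r_n)/n} · as(φ₁, K₁; …; φ_n, K_n). -/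
open MeasureTheory Filter

open Metric Set
open scoped ENNReal Pointwise Topology

theorem aux_polar {n : ℕ} (F : EuclideanSpace ℝ (Fin n) → ℝ≥0∞) (hn : 0 < n) (hF : Measurable F) :
    ∫⁻ x, F x = ∫⁻ u : sphere (0 : EuclideanSpace ℝ (Fin n)) 1,
      (∫⁻ t : Ioi (0 : ℝ), F (t.1 • u.1) ∂(Measure.volumeIoiPow (n - 1)))
        ∂((volume : Measure (EuclideanSpace ℝ (Fin n))).toSphere) := by
  have : Nonempty (Fin n) := ⟨⟨0, hn⟩⟩
  have hmp := (volume : Measure (EuclideanSpace ℝ (Fin n))).measurePreserving_homeomorphUnitSphereProd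
  have hfr : Module.finrank ℝ (EuclideanSpace ℝ (Fin n)) = n := by simp
  rw [hfr] at hmp
  have hm : Measurable (fun p : sphere (0 : EuclideanSpace ℝ (Fin n)) 1 × Ioi (0 : ℝ) =>
      F (p.2.1 • p.1.1)) := by
    fun_prop
  rw [← lintegral_prod _ hm.aemeasurable, ← hmp.lintegral_comp hm]
  have h0 : ∫⁻ x, F x = ∫⁻ x in ({0}ᶜ : Set (EuclideanSpace ℝ (Fin n))), F x := by
    rw [restrict_compl_singleton]
  rw [h0, ← lintegral_subtype_comap (measurableSet_singleton _).compl]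
  apply lintegral_congr
  rintro ⟨x, hx⟩
  have : ‖x‖ ≠ 0 := by simpa using hx
  simp [smul_smul, this]

theorem aux_cov {n : ℕ} (hn : 0 < n)
    (A : EuclideanSpace ℝ (Fin n) →ₗ[ℝ] EuclideanSpace ℝ (Fin n)) (hA : LinearMap.det A ≠ 0)
    (g : EuclideanSpace ℝ (Fin n) → ℝ≥0∞) (hg : Measurable g) :
    ∫⁻ u : sphere (0 : EuclideanSpace ℝ (Fin n)) 1, g u
        ∂((volume : Measure (EuclideanSpace ℝ (Fin n))).toSphere) =
    ∫⁻ u : sphere (0 : EuclideanSpace ℝ (Fin n)) 1,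
        ENNReal.ofReal (|LinearMap.det A| * (‖A u‖⁻¹) ^ n) * g (‖A u‖⁻¹ • A u)
        ∂((volume : Measure (EuclideanSpace ℝ (Fin n))).toSphere) := by
  have : Nonempty (Fin n) := ⟨⟨0, hn⟩⟩
  have hAc : Continuous A := A.continuous_of_finiteDimensional
  have hAm : Measurable A := hAc.measurable
  have hinj : ∀ x, x ≠ 0 → A x ≠ 0 := by
    intro x hx h
    have hk : LinearMap.ker A = ⊥ := by
      by_contra hh
      exact hA (LinearMap.det_eq_zero_iff_ker_ne_bot.2 hh)
    exact hx (by simpa [hk] using (LinearMap.mem_ker.2 h))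
  have hu0 : ∀ u : sphere (0 : EuclideanSpace ℝ (Fin n)) 1, (u : EuclideanSpace ℝ (Fin n)) ≠ 0 :=
    fun u => ne_zero_of_mem_unit_sphere u
  set F : EuclideanSpace ℝ (Fin n) → ℝ≥0∞ := fun x => (Iio (1:ℝ)).indicator 1 ‖x‖ * g (‖x‖⁻¹ • x)
    with hFdef
  have hF : Measurable F := by
    apply Measurable.mul
    · exact (measurable_one.indicator measurableSet_Iio).comp measurable_norm
    · fun_prop
  have key : ∀ c : ℝ, 0 < c → ∫⁻ t : Ioi (0:ℝ), (Iio (1:ℝ)).indicator (1 : ℝ → ℝ≥0∞) (t.1 * c)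
      ∂(Measure.volumeIoiPow (n - 1)) = ENNReal.ofReal (c⁻¹ ^ n / n) := by
    intro c hc
    have h1 : ∀ t : Ioi (0:ℝ), (Iio (1:ℝ)).indicator (1 : ℝ → ℝ≥0∞) (t.1 * c)
        = (Iio (⟨c⁻¹, inv_pos.2 hc⟩ : Ioi (0:ℝ))).indicator 1 t := by
      intro t
      simp only [indicator, mem_Iio, Pi.one_apply]
      congr 1
      exact propext (lt_inv_mul_iff₀' hc |>.symm.trans (by rw [mul_one]; rfl))
    simp_rw [h1]
    rw [lintegral_indicator_one measurableSet_Iio, Measure.volumeIoiPow_apply_Iio]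
    have : n - 1 + 1 = n := by omega
    have h2 : ((n - 1 : ℕ) : ℝ) + 1 = n := by exact_mod_cast this
    rw [this, h2]
  have e1 : ∫⁻ x, F x = ENNReal.ofReal (1 / n) *
      ∫⁻ u : sphere (0 : EuclideanSpace ℝ (Fin n)) 1, g u
        ∂((volume : Measure (EuclideanSpace ℝ (Fin n))).toSphere) := by
    rw [aux_polar F hn hF, ← lintegral_const_mul _ (by fun_prop)]
    apply lintegral_congr
    intro u
    have : ∀ t : Ioi (0:ℝ), F (t.1 • u.1) = (Iio (1:ℝ)).indicator (1 : ℝ → ℝ≥0∞) (t.1 * 1) * g u := by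
      intro t
      have ht : 0 < t.1 := t.2
      simp [hFdef, norm_smul, abs_of_pos ht, smul_smul, inv_mul_cancel₀ ht.ne']
    simp_rw [this]
    rw [lintegral_mul_const, key 1 one_pos]
    · simp
    · exact (measurable_one.indicator measurableSet_Iio).comp (by fun_prop)
  have e2 : ∫⁻ x, F (A x) = ENNReal.ofReal (1 / n) *
      ∫⁻ u : sphere (0 : EuclideanSpace ℝ (Fin n)) 1,
        ENNReal.ofReal ((‖A u‖⁻¹) ^ n) * g (‖A u‖⁻¹ • A u)
        ∂((volume : Measure (EuclideanSpace ℝ (Fin n))).toSphere) := by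
    rw [aux_polar (fun x => F (A x)) hn (by fun_prop), ← lintegral_const_mul _ (by fun_prop)]
    apply lintegral_congr
    intro u
    have hpos : 0 < ‖A u‖ := norm_pos_iff.2 (hinj _ (hu0 u))
    have : ∀ t : Ioi (0:ℝ), F (A (t.1 • u.1)) =
        (Iio (1:ℝ)).indicator (1 : ℝ → ℝ≥0∞) (t.1 * ‖A u‖) * g (‖A u‖⁻¹ • A u) := by
      intro t
      have ht : 0 < t.1 := t.2
      simp only [hFdef, map_smul, norm_smul, Real.norm_eq_abs, abs_of_pos ht, smul_smul]
      congr 3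
      field_simp
    simp_rw [this]
    rw [lintegral_mul_const, key _ hpos, ← mul_assoc, ← ENNReal.ofReal_mul (by positivity)]
    · congr 2; ring
    · exact (measurable_one.indicator measurableSet_Iio).comp (by fun_prop)
  have e3 : ∫⁻ x, F (A x) = ENNReal.ofReal |(LinearMap.det A)⁻¹| * ∫⁻ x, F x := by
    rw [← lintegral_map hF hAm, Measure.map_linearMap_addHaar_eq_smul_addHaar _ hA,
      lintegral_smul_measure, smul_eq_mul]
  rw [e1, e2] at e3
  have hc0 : ENNReal.ofReal (1 / n) ≠ 0 := by
    simp [hn]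
  have hct : ENNReal.ofReal (1 / (n:ℝ)) ≠ ∞ := ENNReal.ofReal_ne_top
  rw [mul_left_comm, ENNReal.mul_right_inj hc0 hct] at e3
  simp_rw [ENNReal.ofReal_mul (abs_nonneg (LinearMap.det A)), mul_assoc]
  rw [lintegral_const_mul _ (by fun_prop), e3, ← mul_assoc, ← ENNReal.ofReal_mul (abs_nonneg _),
    ← abs_mul, mul_inv_cancel₀ hA]
  simp

theorem aux_unique_s10 {n : ℕ} (m₁ m₂ : Measure (EuclideanSpace ℝ (Fin n)))
    [IsFiniteMeasure m₁] [IsFiniteMeasure m₂] (h20 : m₂ ≠ 0)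
    (hs₁ : ∀ᵐ x ∂m₁, ‖x‖ = 1) (hs₂ : ∀ᵐ x ∂m₂, ‖x‖ = 1)
    (hb₁ : ∀ x y : EuclideanSpace ℝ (Fin n), ‖x‖ = 1 → ‖y‖ = 1 → ∀ r,
      m₁ (closedBall x r) = m₁ (closedBall y r))
    (hb₂ : ∀ x y : EuclideanSpace ℝ (Fin n), ‖x‖ = 1 → ‖y‖ = 1 → ∀ r,
      m₂ (closedBall x r) = m₂ (closedBall y r)) :
    ∃ c : ℝ≥0∞, m₁ = c • m₂ := by
  set ρ := m₁ + m₂ with hρ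
  have hsρ : ∀ᵐ x ∂ρ, ‖x‖ = 1 := by
    rw [hρ, ae_add_measure_iff]; exact ⟨hs₁, hs₂⟩
  have hρ0 : ρ ≠ 0 := by
    intro h
    apply h20
    rw [← Measure.measure_univ_eq_zero] at h ⊢
    rw [hρ, Measure.add_apply] at h
    exact (add_eq_zero.1 h).2
  have hρf : IsFiniteMeasure ρ := by rw [hρ]; infer_instance
  have gen : ∀ m : Measure (EuclideanSpace ℝ (Fin n)), IsFiniteMeasure m → m ≪ ρ →
      (∀ x y : EuclideanSpace ℝ (Fin n), ‖x‖ = 1 → ‖y‖ = 1 → ∀ r,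
        m (closedBall x r) = m (closedBall y r)) → ∃ c : ℝ≥0∞, m = c • ρ := by
    intro m hm hac hb
    have hae := (Besicovitch.ae_tendsto_rnDeriv m ρ).and hsρ
    have : NeBot (ae ρ) := ae_neBot.2 hρ0
    obtain ⟨x0, hx0, hx01⟩ := hae.exists
    refine ⟨m.rnDeriv ρ x0, ?_⟩
    have hconst : m.rnDeriv ρ =ᵐ[ρ] fun _ => m.rnDeriv ρ x0 := by
      filter_upwards [hae] with x hx
      refine tendsto_nhds_unique hx.1 ?_
      refine hx0.congr fun r => ?_
      rw [hb x0 x hx01 hx.2 r, hρ, Measure.add_apply, Measure.add_apply,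
        hb₁ x0 x hx01 hx.2 r, hb₂ x0 x hx01 hx.2 r]
    have hdec : m.HaveLebesgueDecomposition ρ :=
      Measure.haveLebesgueDecomposition_of_sigmaFinite m ρ
    have hwd := Measure.withDensity_rnDeriv_eq m ρ hac
    rw [withDensity_congr_ae hconst, withDensity_const] at hwd
    exact hwd.symm
  obtain ⟨c, hc⟩ := gen m₁ inferInstance
    (Measure.absolutelyContinuous_of_le (Measure.le_add_right le_rfl)) hb₁
  obtain ⟨d, hd⟩ := gen m₂ inferInstance
    (Measure.absolutelyContinuous_of_le (Measure.le_add_left le_rfl)) hb₂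
  have hd0 : d ≠ 0 := by
    rintro rfl
    exact h20 (by simpa using hd)
  have hdt : d ≠ ∞ := by
    rintro rfl
    have h1 : m₂ univ = ∞ := by
      rw [hd, Measure.smul_apply, smul_eq_mul, ENNReal.top_mul]
      rwa [ne_eq, Measure.measure_univ_eq_zero]
    exact measure_ne_top m₂ univ h1
  refine ⟨c * d⁻¹, ?_⟩
  rw [hc, hd, smul_smul, mul_assoc, ENNReal.inv_mul_cancel hd0 hdt, mul_one]

theorem aux_ball {n : ℕ} (m : Measure (sphere (0 : EuclideanSpace ℝ (Fin n)) 1))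
    (M : Set (EuclideanSpace ℝ (Fin n)) → ℝ≥0∞)
    (hM : ∀ s, MeasurableSet s → m s = M (Subtype.val '' s))
    (hinv : ∀ (L : EuclideanSpace ℝ (Fin n) ≃ₗᵢ[ℝ] EuclideanSpace ℝ (Fin n)) s, M (L '' s) = M s)
    (x y : EuclideanSpace ℝ (Fin n)) (hx : ‖x‖ = 1) (hy : ‖y‖ = 1) (r : ℝ) :
    m.map Subtype.val (closedBall x r) = m.map Subtype.val (closedBall y r) := by
  rw [Measure.map_apply measurable_subtype_coe measurableSet_closedBall,
    Measure.map_apply measurable_subtype_coe measurableSet_closedBall,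
    hM _ (measurable_subtype_coe measurableSet_closedBall),
    hM _ (measurable_subtype_coe measurableSet_closedBall)]
  set L := Submodule.reflection (Submodule.span ℝ {x - y})ᗮ with hL
  have hLx : L x = y := Submodule.reflection_sub (by rw [hx, hy])
  rw [← hinv L, Subtype.image_preimage_coe, Subtype.image_preimage_coe]
  congr 1
  rw [image_inter L.injective, L.image_closedBall, L.image_sphere, hLx, map_zero]

theorem aux_prop {n : ℕ} (hn : 0 < n)
    (hfin : (μH[(n - 1 : ℝ)] : Measure (sphere (0 : EuclideanSpace ℝ (Fin n)) 1)) univ ≠ ∞) :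
    ∃ c : ℝ≥0∞, (μH[(n - 1 : ℝ)] : Measure (sphere (0 : EuclideanSpace ℝ (Fin n)) 1)) =
      c • ((volume : Measure (EuclideanSpace ℝ (Fin n))).toSphere) := by
  have : Nonempty (Fin n) := ⟨⟨0, hn⟩⟩
  have hd : (0:ℝ) ≤ n - 1 := by
    have : (1:ℝ) ≤ n := by exact_mod_cast hn
    linarith
  set μ := (μH[(n - 1 : ℝ)] : Measure (sphere (0 : EuclideanSpace ℝ (Fin n)) 1)) with hμ
  set σ := (volume : Measure (EuclideanSpace ℝ (Fin n))).toSphere with hσ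
  have : IsFiniteMeasure μ := ⟨lt_top_iff_ne_top.2 hfin⟩
  have hemb : MeasurableEmbedding
      (Subtype.val : sphere (0 : EuclideanSpace ℝ (Fin n)) 1 → EuclideanSpace ℝ (Fin n)) :=
    MeasurableEmbedding.subtype_coe isClosed_sphere.measurableSet
  have hs : ∀ m : Measure (sphere (0 : EuclideanSpace ℝ (Fin n)) 1),
      ∀ᵐ x ∂(m.map Subtype.val), ‖x‖ = 1 := by
    intro m
    rw [hemb.ae_map_iff]
    exact Eventually.of_forall fun u => by simp
  have hσ0 : σ.map Subtype.val ≠ 0 := by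
    intro h
    have h1 : σ = 0 := by
      rw [← hemb.comap_map σ, h, Measure.comap_zero]
    exact Measure.toSphere_ne_zero _ h1
  obtain ⟨c, hc⟩ := aux_unique_s10 (μ.map Subtype.val) (σ.map Subtype.val) hσ0 (hs _) (hs _)
    (aux_ball μ (fun s => μH[(n - 1 : ℝ)] s)
      (fun s _ => (isometry_subtype_coe.hausdorffMeasure_image (Or.inl hd) s).symm)
      (fun L s => L.isometry.hausdorffMeasure_image (Or.inl hd) s))
    (aux_ball σ (fun s => Module.finrank ℝ (EuclideanSpace ℝ (Fin n)) * volume (Ioo (0:ℝ) 1 • s))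
      (fun s hs => Measure.toSphere_apply' _ hs)
      (fun L s => by
        have : Ioo (0:ℝ) 1 • (L '' s) = L '' (Ioo (0:ℝ) 1 • s) := by
          ext z
          simp only [Set.mem_smul, mem_image]
          constructor
          · rintro ⟨t, ht, _, ⟨y, hy, rfl⟩, rfl⟩
            exact ⟨t • y, ⟨t, ht, y, hy, rfl⟩, by simp⟩
          · rintro ⟨_, ⟨t, ht, y, hy, rfl⟩, rfl⟩
            exact ⟨t, ht, L y, ⟨y, hy, rfl⟩, by simp⟩
        simp only [this]
        congr 1
        have hp := L.symm.measurePreserving.measure_preimage_equiv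
          (f := L.symm.toMeasurableEquiv) (Ioo (0:ℝ) 1 • s)
        rw [← hp]
        congr 1
        ext z
        simp only [mem_image, mem_preimage]
        constructor
        · rintro ⟨y, hy, rfl⟩
          simpa using hy
        · intro hz
          exact ⟨_, hz, by simp⟩))
    
  · refine ⟨c, ?_⟩
    rw [← hemb.comap_map μ, hc, Measure.comap_smul, hemb.comap_map]

theorem aux_det {n : ℕ} (T : EuclideanSpace ℝ (Fin n) ≃ₗ[ℝ] EuclideanSpace ℝ (Fin n)) :
    LinearMap.det (LinearMap.adjoint T.symm.toLinearMap) = (LinearMap.det T.toLinearMap)⁻¹ := by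
  have h1 : LinearMap.det (LinearMap.adjoint T.symm.toLinearMap)
      = LinearMap.det T.symm.toLinearMap := by
    have b := EuclideanSpace.basisFun (Fin n) ℝ
    rw [← LinearMap.det_toMatrix b.toBasis, LinearMap.toMatrix_adjoint, Matrix.det_conjTranspose,
      LinearMap.det_toMatrix]
    simp
  rw [h1]
  exact LinearEquiv.det_coe_symm T

theorem aux_undef {X : Type*} [TopologicalSpace X] [CompactSpace X] [MeasurableSpace X]
    (μ : Measure X) (hμ : μ univ = ∞) (g : X → ℝ) (hg : Continuous g) (hpos : ∀ x, 0 < g x) :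
    ∫ x, g x ∂μ = 0 := by
  apply integral_undef
  intro hint
  rcases isEmpty_or_nonempty X with hX | hX
  · rw [univ_eq_empty_iff.2 hX] at hμ
    simp at hμ
  obtain ⟨x0, -, hx0'⟩ := isCompact_univ.exists_isMinOn univ_nonempty hg.continuousOn
  have hx0 : ∀ x, g x0 ≤ g x := fun x => hx0' (mem_univ x)
  have hc : Integrable (fun _ : X => g x0) μ := by
    refine hint.mono' aestronglyMeasurable_const (Eventually.of_forall fun x => ?_)
    rw [Real.norm_eq_abs, abs_of_pos (hpos _)]
    exact hx0 x
  rcases integrable_const_iff.1 hc with h | h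
  · exact (hpos x0).ne' h
  · exact h.measure_univ_lt_top.ne hμ

/-- The explicit form of the integrand for power functions. -/
noncomputable def auxG {n : ℕ} (h f : Fin n → EuclideanSpace ℝ (Fin n) → ℝ) (a r : Fin n → ℝ)
    (x : EuclideanSpace ℝ (Fin n)) : ℝ :=
  ∏ i, (a i * (1 / (f i x * h i x ^ (n + 1))) ^ r i * h i x * f i x) ^ ((n : ℝ)⁻¹)

theorem auxG_measurable {n : ℕ} (h f : Fin n → EuclideanSpace ℝ (Fin n) → ℝ) (a r : Fin n → ℝ)
    (hc : ∀ i, Continuous (h i)) (fc : ∀ i, Continuous (f i)) : Measurable (auxG h f a r) := by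
  have h1 := fun i => (hc i).measurable
  have h2 := fun i => (fc i).measurable
  unfold auxG
  fun_prop

theorem auxG_pos {n : ℕ} (h f : Fin n → EuclideanSpace ℝ (Fin n) → ℝ) (a r : Fin n → ℝ)
    (ha : ∀ i, 0 < a i)
    (hp : ∀ i x, ‖x‖ = 1 → 0 < h i x) (fp : ∀ i x, ‖x‖ = 1 → 0 < f i x)
    (x : EuclideanSpace ℝ (Fin n)) (hx : ‖x‖ = 1) : 0 < auxG h f a r x := by
  unfold auxG
  refine Finset.prod_pos fun i _ => ?_
  have := hp i x hx
  have := fp i x hx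
  have := ha i
  positivity

theorem auxG_cont {n : ℕ} (h f : Fin n → EuclideanSpace ℝ (Fin n) → ℝ) (a r : Fin n → ℝ)
    (ha : ∀ i, 0 < a i)
    (hp : ∀ i x, ‖x‖ = 1 → 0 < h i x) (fp : ∀ i x, ‖x‖ = 1 → 0 < f i x)
    (hc : ∀ i, Continuous (h i)) (fc : ∀ i, Continuous (f i)) :
    Continuous (fun u : sphere (0 : EuclideanSpace ℝ (Fin n)) 1 => auxG h f a r u) := by
  unfold auxG
  refine continuous_finsetProd _ fun i _ => ?_
  have h1 := fun u : sphere (0 : EuclideanSpace ℝ (Fin n)) 1 => hp i u (by simp)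
  have h2 := fun u : sphere (0 : EuclideanSpace ℝ (Fin n)) 1 => fp i u (by simp)
  have h3 : Continuous (fun u : sphere (0 : EuclideanSpace ℝ (Fin n)) 1 => h i u) :=
    (hc i).comp continuous_subtype_val
  have h4 : Continuous (fun u : sphere (0 : EuclideanSpace ℝ (Fin n)) 1 => f i u) :=
    (fc i).comp continuous_subtype_val
  have h5 : Continuous (fun u : sphere (0 : EuclideanSpace ℝ (Fin n)) 1 =>
      1 / (f i u * h i u ^ (n + 1))) :=
    continuous_const.div (h4.mul (h3.pow _)) fun u =>
      (mul_pos (h2 u) (pow_pos (h1 u) _)).ne'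
  have h6 := h5.rpow_const (p := r i) fun u => Or.inl
    (one_div_pos.2 (mul_pos (h2 u) (pow_pos (h1 u) _))).ne'
  refine (((continuous_const.mul h6).mul h3).mul h4).rpow_const fun u => Or.inl ?_
  have h7 := h1 u
  have h8 := h2 u
  have h9 := ha i
  have h10 : 0 < (1 / (f i u * h i u ^ (n + 1))) ^ r i := by positivity
  exact (mul_pos (mul_pos (mul_pos h9 h10) h7) h8).ne'

theorem auxG_trans {n : ℕ} (hn : 0 < n) (h f h' f' : Fin n → EuclideanSpace ℝ (Fin n) → ℝ)
    (a r : Fin n → ℝ) (ha : ∀ i, 0 < a i) (x y : EuclideanSpace ℝ (Fin n))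
    (hp : ∀ i, 0 < h i x) (fp : ∀ i, 0 < f i x) (D c : ℝ) (hD : D ≠ 0) (hc : 0 < c)
    (h1 : ∀ i, f' i y * h' i y ^ (n + 1) = D ^ 2 * f i x * h i x ^ (n + 1))
    (h2 : ∀ i, f' i y * h' i y = D ^ 2 * c ^ n * f i x * h i x) :
    |D⁻¹| * (c⁻¹) ^ n * auxG h' f' a r y = |D| ^ ((1 : ℝ) - 2 * (∑ i, r i) / n) * auxG h f a r x := by
  have hn' : (n : ℝ) ≠ 0 := by exact_mod_cast hn.ne'
  have hd : 0 < |D| := abs_pos.2 hD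
  have hfac : ∀ i, (a i * (1 / (f' i y * h' i y ^ (n + 1))) ^ r i * h' i y * f' i y) ^ ((n : ℝ)⁻¹)
      = |D| ^ ((2 - 2 * r i) / n) * c *
        (a i * (1 / (f i x * h i x ^ (n + 1))) ^ r i * h i x * f i x) ^ ((n : ℝ)⁻¹) := by
    intro i
    have hp := hp i
    have fp := fp i
    have ha := ha i
    have e0 : D ^ 2 = |D| ^ (2 : ℝ) := by
      rw [← sq_abs]; norm_cast
    have e1 : (1 / (f' i y * h' i y ^ (n + 1))) ^ r i
        = |D| ^ (-2 * r i) * (1 / (f i x * h i x ^ (n + 1))) ^ r i := by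
      rw [h1 i, mul_assoc, ← one_div_mul_one_div,
        Real.mul_rpow (by positivity) (by positivity), e0, one_div, ← Real.rpow_neg hd.le,
        ← Real.rpow_mul hd.le]
    have e2 : a i * (1 / (f' i y * h' i y ^ (n + 1))) ^ r i * h' i y * f' i y
        = (|D| ^ (2 - 2 * r i) * c ^ n) *
          (a i * (1 / (f i x * h i x ^ (n + 1))) ^ r i * h i x * f i x) := by
      have e3 : |D| ^ (2 - 2 * r i) = D ^ 2 * |D| ^ (-2 * r i) := by
        rw [e0, ← Real.rpow_add hd]; congr 1; ring
      rw [mul_assoc, mul_comm (h' i y), h2 i, e1, e3]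
      ring
    rw [e2, Real.mul_rpow (by positivity) (by positivity),
      Real.mul_rpow (by positivity) (by positivity), ← Real.rpow_mul hd.le,
      Real.pow_rpow_inv_natCast hc.le hn.ne', div_eq_mul_inv (2 - 2 * r i)]
  unfold auxG
  simp_rw [hfac]
  rw [Finset.prod_mul_distrib, Finset.prod_mul_distrib, ← Real.rpow_sum_of_pos hd,
    Finset.prod_const, Finset.card_univ, Fintype.card_fin]
  have e4 : ∑ i, (2 - 2 * r i) / (n : ℝ) = 1 + (1 - 2 * (∑ i, r i) / n) := by
    rw [← Finset.sum_div, Finset.sum_sub_distrib, ← Finset.mul_sum]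
    simp
    field_simp
    ring
  rw [e4, Real.rpow_add hd, Real.rpow_one, abs_inv, inv_pow]
  field_simp

/-- homogeneity of the general mixed `L_φ`-affine surface area under
invertible linear maps, for `φ_i` homogeneous of degrees `r_i ∈ [0,1)`:
`as(φ₁,TK₁;…;φ_n,TK_n) = |det T|^{1-2(r₁+⋯+r_n)/n}·as(φ₁,K₁;…;φ_n,K_n)`.  The bodies `K_i` and `TK_i` of class `C²₊` are encoded by
their support functions `hK i`, `hTK i` and curvature functions `fK i`, `fTK i`, related by
the standard transformation rules at `v = T^{-t}u/‖T^{-t}u‖`. -/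
theorem stmt10 {n : ℕ} (hn : 0 < n)
    (T : EuclideanSpace ℝ (Fin n) ≃ₗ[ℝ] EuclideanSpace ℝ (Fin n))
    (hK fK hTK fTK : Fin n → EuclideanSpace ℝ (Fin n) → ℝ)
    (hKpos : ∀ i x, ‖x‖ = 1 → 0 < hK i x) (fKpos : ∀ i x, ‖x‖ = 1 → 0 < fK i x)
    (hTKpos : ∀ i x, ‖x‖ = 1 → 0 < hTK i x) (fTKpos : ∀ i x, ‖x‖ = 1 → 0 < fTK i x)
    (hKcont : ∀ i, Continuous (hK i)) (fKcont : ∀ i, Continuous (fK i))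
    (hTKcont : ∀ i, Continuous (hTK i)) (fTKcont : ∀ i, Continuous (fTK i))
    (htrans1 : ∀ i, ∀ u : EuclideanSpace ℝ (Fin n), ‖u‖ = 1 →
      fTK i (‖(LinearMap.adjoint T.symm.toLinearMap) u‖⁻¹ • (LinearMap.adjoint T.symm.toLinearMap) u)
          * hTK i (‖(LinearMap.adjoint T.symm.toLinearMap) u‖⁻¹ • (LinearMap.adjoint T.symm.toLinearMap) u) ^ (n + 1)
        = (LinearMap.det T.toLinearMap) ^ 2 * fK i u * hK i u ^ (n + 1))
    (htrans2 : ∀ i, ∀ u : EuclideanSpace ℝ (Fin n), ‖u‖ = 1 →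
      fTK i (‖(LinearMap.adjoint T.symm.toLinearMap) u‖⁻¹ • (LinearMap.adjoint T.symm.toLinearMap) u)
          * hTK i (‖(LinearMap.adjoint T.symm.toLinearMap) u‖⁻¹ • (LinearMap.adjoint T.symm.toLinearMap) u)
        = (LinearMap.det T.toLinearMap) ^ 2 * ‖(LinearMap.adjoint T.symm.toLinearMap) u‖ ^ (n : ℕ)
            * fK i u * hK i u)
    (φ : Fin n → ℝ → ℝ) (hφ : ∀ i, MemConc (φ i))
    (r : Fin n → ℝ) (hr : ∀ i, 0 ≤ r i ∧ r i < 1)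
    (hhom : ∀ i, ∀ l t : ℝ, 0 < l → 0 < t → φ i (l * t) = l ^ r i * φ i t) :
    (∫ u : Metric.sphere (0 : EuclideanSpace ℝ (Fin n)) 1,
        ∏ i, (φ i (1 / (fTK i u * hTK i (u : EuclideanSpace ℝ (Fin n)) ^ (n + 1)))
          * hTK i u * fTK i u) ^ ((n : ℝ)⁻¹) ∂(μH[(n - 1 : ℝ)]))
      = |LinearMap.det T.toLinearMap| ^ ((1 : ℝ) - 2 * (∑ i, r i) / n) *
        ∫ u : Metric.sphere (0 : EuclideanSpace ℝ (Fin n)) 1,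
          ∏ i, (φ i (1 / (fK i u * hK i (u : EuclideanSpace ℝ (Fin n)) ^ (n + 1)))
            * hK i u * fK i u) ^ ((n : ℝ)⁻¹) ∂(μH[(n - 1 : ℝ)]) := by
  have ha : ∀ i, 0 < φ i 1 := fun i => (hφ i).1 1 one_pos
  have hφt : ∀ i t, 0 < t → φ i t = φ i 1 * t ^ r i := by
    intro i t ht
    have := hhom i t 1 ht one_pos
    rw [mul_one] at this
    rw [this, mul_comm]
  have hD : LinearMap.det T.toLinearMap ≠ 0 := by
    have := LinearEquiv.isUnit_det' T
    exact this.ne_zero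
  have conv : ∀ h f : Fin n → EuclideanSpace ℝ (Fin n) → ℝ,
      (∀ i x, ‖x‖ = 1 → 0 < h i x) → (∀ i x, ‖x‖ = 1 → 0 < f i x) →
      ∀ u : Metric.sphere (0 : EuclideanSpace ℝ (Fin n)) 1,
        ∏ i, (φ i (1 / (f i u * h i (u : EuclideanSpace ℝ (Fin n)) ^ (n + 1)))
          * h i u * f i u) ^ ((n : ℝ)⁻¹) = auxG h f (fun i => φ i 1) r u := by
    intro h f hp fp u
    unfold auxG
    refine Finset.prod_congr rfl fun i _ => ?_
    have h1 := hp i u (by simp)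
    have h2 := fp i u (by simp)
    rw [hφt i _ (by positivity)]
  simp_rw [conv hTK fTK hTKpos fTKpos, conv hK fK hKpos fKpos]
  have c1 := auxG_cont hTK fTK (fun i => φ i 1) r ha hTKpos fTKpos hTKcont fTKcont
  have c2 := auxG_cont hK fK (fun i => φ i 1) r ha hKpos fKpos hKcont fKcont
  have p1 := auxG_pos hTK fTK (fun i => φ i 1) r ha hTKpos fTKpos
  have p2 := auxG_pos hK fK (fun i => φ i 1) r ha hKpos fKpos
  by_cases hfin :
      (μH[(n - 1 : ℝ)] : Measure (sphere (0 : EuclideanSpace ℝ (Fin n)) 1)) univ = ∞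
  · rw [aux_undef _ hfin _ c1 fun u => p1 u (by simp), aux_undef _ hfin _ c2 fun u => p2 u (by simp),
      mul_zero]
  obtain ⟨c, hc⟩ := aux_prop hn hfin
  have hdet := aux_det T
  have hdet0 : LinearMap.det (LinearMap.adjoint T.symm.toLinearMap) ≠ 0 := by
    rw [hdet]; exact inv_ne_zero hD
  have hm : Measurable fun x => ENNReal.ofReal (auxG hTK fTK (fun i => φ i 1) r x) :=
    (auxG_measurable hTK fTK (fun i => φ i 1) r hTKcont fTKcont).ennreal_ofReal
  have hcov := aux_cov hn _ hdet0 _ hm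
  rw [← integral_const_mul, hc,
    integral_eq_lintegral_of_nonneg_ae
      (f := fun u : sphere (0 : EuclideanSpace ℝ (Fin n)) 1 => auxG hTK fTK (fun i => φ i 1) r u)
      (Eventually.of_forall fun u => (p1 u (by simp)).le)
      c1.aestronglyMeasurable,
    integral_eq_lintegral_of_nonneg_ae
      (f := fun u : sphere (0 : EuclideanSpace ℝ (Fin n)) 1 =>
        |LinearMap.det T.toLinearMap| ^ ((1 : ℝ) - 2 * (∑ i, r i) / n) *
          auxG hK fK (fun i => φ i 1) r u)
      (Eventually.of_forall fun u => mul_nonneg (by positivity) (p2 u (by simp)).le)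
      (continuous_const.mul c2).aestronglyMeasurable,
    lintegral_smul_measure, lintegral_smul_measure, hcov]
  congr 2
  refine lintegral_congr fun u => ?_
  have hu : ‖(u : EuclideanSpace ℝ (Fin n))‖ = 1 := by simp
  have hApos : 0 < ‖(LinearMap.adjoint T.symm.toLinearMap) (u : EuclideanSpace ℝ (Fin n))‖ := by
    rw [norm_pos_iff]
    intro h0
    have hk : LinearMap.ker (LinearMap.adjoint T.symm.toLinearMap) = ⊥ := by
      by_contra hh
      exact hdet0 (LinearMap.det_eq_zero_iff_ker_ne_bot.2 hh)
    have hu0 : (u : EuclideanSpace ℝ (Fin n)) = 0 := by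
      simpa [hk] using (LinearMap.mem_ker.2 h0)
    rw [hu0] at hu
    simp at hu
  rw [← ENNReal.ofReal_mul (by positivity), hdet]
  congr 1
  exact auxG_trans hn hK fK hTK fTK _ r ha u _ (fun i => hKpos i u hu) (fun i => fKpos i u hu) _ _
    hD hApos (fun i => htrans1 i u hu) (fun i => htrans2 i u hu)
end
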